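/- arXiv:1608.04750 — 2 statements merged into one kernel-verified Lean document; each statement's English description precedes it below -/
import Mathlib

section
/- For every odd integer d, the bipartite unitary U_S on ℂ^d⊗ℂ^d defined on computational basis states by U_S|i⟩|j⟩ = |i+j mod d⟩|i−j mod d⟩ is indeed unitary and is maximally I₃-scrambling: its Choi state satisfies I₃(A;C;D) = −2 log₂ d; equivalently, every two-party reduced density matrix of its Choi state is maximally mixed. -/
open Matrix Kronecker Filter
open scoped BigOperators Classical ComplexOrder

noncomputable section

namespace Scrambling

/-- The maximally mixed state on a finite-dimensional system `X`. -/
def mmState (X : Type*) [Fintype X] [DecidableEq X] : Matrix X X ℂ :=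
  (Fintype.card X : ℂ)⁻¹ • 1

/-- A (possibly rectangular) matrix is unitary if `U Uᴴ = 1` and `Uᴴ U = 1`. -/
def IsUnitaryMat {m n : Type*} [Fintype m] [Fintype n] [DecidableEq m] [DecidableEq n]
    (U : Matrix m n ℂ) : Prop :=
  U * Uᴴ = 1 ∧ Uᴴ * U = 1

/-- Reduced density matrix of a pure state `ψ` on `X ⊗ Y`, tracing out `Y`. -/
def redDM {X Y : Type*} [Fintype Y] (ψ : X × Y → ℂ) : Matrix X X ℂ :=
  Matrix.of fun x x' => ∑ y, ψ (x, y) * star (ψ (x', y))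

/-- Base-2 von Neumann entropy of a (Hermitian) matrix: `S(ρ) = -tr (ρ log₂ ρ)`,
computed via the eigenvalues. Junk value `0` for non-Hermitian matrices. -/
def vNE {n : Type*} [Fintype n] [DecidableEq n] (ρ : Matrix n n ℂ) : ℝ :=
  if h : ρ.IsHermitian then (∑ i, Real.negMulLog (h.eigenvalues i)) / Real.log 2 else 0

/-- Trace norm `‖X‖₁ = tr √(XᴴX)`, via the eigenvalues of `XᴴX`. -/
def traceNorm {n : Type*} [Fintype n] [DecidableEq n] (X : Matrix n n ℂ) : ℝ :=
  ∑ i, Real.sqrt ((Matrix.posSemidef_conjTranspose_mul_self X).1.eigenvalues i)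

/-- Density matrix: positive semidefinite with unit trace. -/
def IsDensityMatrix {n : Type*} [Fintype n] (ρ : Matrix n n ℂ) : Prop :=
  ρ.PosSemidef ∧ ρ.trace = 1

/-- The pure density matrix `|ψ⟩⟨ψ|` associated to a state vector. -/
def pureDM {T : Type*} (ψ : T → ℂ) : Matrix T T ℂ :=
  Matrix.of fun x y => ψ x * star (ψ y)

/-- Extension `id_R ⊗ Φ` of a (linear) map `Φ` on matrices to a reference system `R`. -/
def extendCh {R A C : Type*} (Φ : Matrix A A ℂ → Matrix C C ℂ)
    (ρ : Matrix (R × A) (R × A) ℂ) : Matrix (R × C) (R × C) ℂ :=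
  Matrix.of fun p q => Φ (Matrix.of fun x y => ρ (p.1, x) (q.1, y)) p.2 q.2

/-- Diamond-norm distance between two (linear) maps on matrices:
the supremum over all finite-dimensional reference systems `R = Fin n` and all density
matrices `ρ` on `R ⊗ A` of the trace norm of the difference of the extended outputs. -/
def diamondDist {A C : Type*} [Fintype A] [DecidableEq A] [Fintype C] [DecidableEq C]
    (Φ Ψ : Matrix A A ℂ → Matrix C C ℂ) : ℝ :=
  sSup {x | ∃ (n : ℕ) (ρ : Matrix (Fin n × A) (Fin n × A) ℂ),
    IsDensityMatrix ρ ∧ x = traceNorm (extendCh Φ ρ - extendCh Ψ ρ)}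

/-- The unitary quantum channel `σ ↦ U σ Uᴴ`. -/
def uChannel {m n : Type*} [Fintype m] [Fintype n] (U : Matrix m n ℂ) : Matrix n n ℂ → Matrix m m ℂ :=
  fun σ => U * σ * Uᴴ

/-- The completely depolarizing channel `σ ↦ tr(σ) · τ_C`. -/
def depol (A C : Type*) [Fintype A] [Fintype C] [DecidableEq C] :
    Matrix A A ℂ → Matrix C C ℂ :=
  fun σ => σ.trace • mmState C

section FourParty

variable {A B C D : Type*} [Fintype A] [Fintype B] [Fintype C] [Fintype D]
  [DecidableEq A] [DecidableEq B] [DecidableEq C] [DecidableEq D]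

/-- State vector of the Choi state of a bipartite unitary `U : AB → CD`:
`|U⟩ = (1 ⊗ U)(|Φ⁺⟩_{AA'} ⊗ |Φ⁺⟩_{BB'})`. -/
def choiVec (U : Matrix (C × D) (A × B) ℂ) : (A × B) × C × D → ℂ :=
  fun p => (Real.sqrt (Fintype.card A * Fintype.card B) : ℂ)⁻¹ * U p.2 p.1

/-- Density matrix of the Choi state of a bipartite unitary. -/
def choiDM (U : Matrix (C × D) (A × B) ℂ) :
    Matrix ((A × B) × C × D) ((A × B) × C × D) ℂ :=
  pureDM (choiVec U)

variable (ψ : (A × B) × C × D → ℂ)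

/-- Reduced density matrices of a four-party pure state on `A ⊗ B ⊗ C ⊗ D`. -/
def rhoA : Matrix A A ℂ :=
  redDM fun p : A × (B × C × D) => ψ ((p.1, p.2.1), (p.2.2.1, p.2.2.2))

def rhoB : Matrix B B ℂ :=
  redDM fun p : B × (A × C × D) => ψ ((p.2.1, p.1), (p.2.2.1, p.2.2.2))

def rhoC : Matrix C C ℂ :=
  redDM fun p : C × (A × B × D) => ψ ((p.2.1, p.2.2.1), (p.1, p.2.2.2))

def rhoD : Matrix D D ℂ :=
  redDM fun p : D × (A × B × C) => ψ ((p.2.1, p.2.2.1), (p.2.2.2, p.1))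

def rhoAB : Matrix (A × B) (A × B) ℂ := redDM ψ

def rhoAC : Matrix (A × C) (A × C) ℂ :=
  redDM fun p : (A × C) × B × D => ψ ((p.1.1, p.2.1), (p.1.2, p.2.2))

def rhoAD : Matrix (A × D) (A × D) ℂ :=
  redDM fun p : (A × D) × B × C => ψ ((p.1.1, p.2.1), (p.2.2, p.1.2))

def rhoBC : Matrix (B × C) (B × C) ℂ :=
  redDM fun p : (B × C) × A × D => ψ ((p.2.1, p.1.1), (p.1.2, p.2.2))

def rhoBD : Matrix (B × D) (B × D) ℂ :=
  redDM fun p : (B × D) × A × C => ψ ((p.2.1, p.1.1), (p.2.2, p.1.2))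

def rhoCD : Matrix (C × D) (C × D) ℂ :=
  redDM fun p : (C × D) × A × B => ψ (p.2, p.1)

def rhoABC : Matrix ((A × B) × C) ((A × B) × C) ℂ :=
  redDM fun p : ((A × B) × C) × D => ψ (p.1.1, (p.1.2, p.2))

def rhoABD : Matrix ((A × B) × D) ((A × B) × D) ℂ :=
  redDM fun p : ((A × B) × D) × C => ψ (p.1.1, (p.2, p.1.2))

def rhoACD : Matrix (A × C × D) (A × C × D) ℂ :=
  redDM fun p : (A × C × D) × B => ψ ((p.1.1, p.2), p.1.2)

def rhoBCD : Matrix (B × C × D) (B × C × D) ℂ :=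
  redDM fun p : (B × C × D) × A => ψ ((p.2, p.1.1), p.1.2)

/-- Subsystem von Neumann entropies. -/
def SA : ℝ := vNE (rhoA ψ)
def SB : ℝ := vNE (rhoB ψ)
def SC : ℝ := vNE (rhoC ψ)
def SD : ℝ := vNE (rhoD ψ)
def SAB : ℝ := vNE (rhoAB ψ)
def SAC : ℝ := vNE (rhoAC ψ)
def SAD : ℝ := vNE (rhoAD ψ)
def SBC : ℝ := vNE (rhoBC ψ)
def SBD : ℝ := vNE (rhoBD ψ)
def SCD : ℝ := vNE (rhoCD ψ)
def SABC : ℝ := vNE (rhoABC ψ)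
def SABD : ℝ := vNE (rhoABD ψ)
def SACD : ℝ := vNE (rhoACD ψ)
def SBCD : ℝ := vNE (rhoBCD ψ)

/-- Mutual informations `I(X;Y) = S(X) + S(Y) - S(XY)`. -/
def IAB : ℝ := SA ψ + SB ψ - SAB ψ
def IAC : ℝ := SA ψ + SC ψ - SAC ψ
def IAD : ℝ := SA ψ + SD ψ - SAD ψ
def IBC : ℝ := SB ψ + SC ψ - SBC ψ
def IBD : ℝ := SB ψ + SD ψ - SBD ψ
def ICD : ℝ := SC ψ + SD ψ - SCD ψ
def IACD : ℝ := SA ψ + SCD ψ - SACD ψ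

/-- Tripartite information `I₃(A;C;D) = I(A;C) + I(A;D) - I(A;CD)`. -/
def I3ACD : ℝ := IAC ψ + IAD ψ - IACD ψ

/-- Conditional mutual informations. -/
def cmiAB_C : ℝ := SAC ψ + SBC ψ - SC ψ - SABC ψ
def cmiAB_D : ℝ := SAD ψ + SBD ψ - SD ψ - SABD ψ
def cmiCD_A : ℝ := SAC ψ + SAD ψ - SA ψ - SACD ψ
def cmiCD_B : ℝ := SBC ψ + SBD ψ - SB ψ - SBCD ψ

/-- Rényi-2 entropy `S₂(ρ) = -log₂ tr ρ²`. -/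
def S2 {n : Type*} [Fintype n] (ρ : Matrix n n ℂ) : ℝ :=
  -Real.logb 2 ((ρ * ρ).trace.re)

/-- Rényi-2 tripartite information `I₃⁽²⁾ = S₂(A) + S₂(B) - S₂(AC) - S₂(AD)`. -/
def I3r2 : ℝ := S2 (rhoA ψ) + S2 (rhoB ψ) - S2 (rhoAC ψ) - S2 (rhoAD ψ)

end FourParty

/-- The residual channel `N_{A→C}(σ) = tr_D [U (σ ⊗ τ_B) Uᴴ]`. -/
def residual {A B C D : Type*} [Fintype A] [Fintype B] [Fintype C] [Fintype D]
    [DecidableEq A] [DecidableEq B]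
    (U : Matrix (C × D) (A × B) ℂ) (σ : Matrix A A ℂ) : Matrix C C ℂ :=
  Matrix.of fun c c' => ∑ d, (U * (σ ⊗ₖ mmState B) * Uᴴ) (c, d) (c', d)

/-- A unitary on `X ⊗ X` is a perfect tensor iff all two-party marginals of its
Choi state are maximally mixed. -/
def PerfectTensor {X : Type*} [Fintype X] [DecidableEq X]
    (U : Matrix (X × X) (X × X) ℂ) : Prop :=
  rhoAB (choiVec U) = mmState (X × X) ∧ rhoAC (choiVec U) = mmState (X × X) ∧
  rhoAD (choiVec U) = mmState (X × X) ∧ rhoBC (choiVec U) = mmState (X × X) ∧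
  rhoBD (choiVec U) = mmState (X × X) ∧ rhoCD (choiVec U) = mmState (X × X)

/-- The unitary `U_d` which acts as `U_S` on the subspace spanned by the first `d_S`
basis vectors of each tensor factor, and as the identity otherwise. -/
def embedU (dS d : ℕ) (h : dS ≤ d) (US : Matrix (Fin dS × Fin dS) (Fin dS × Fin dS) ℂ) :
    Matrix (Fin d × Fin d) (Fin d × Fin d) ℂ :=
  Matrix.of fun o i =>
    if hi : i.1.val < dS ∧ i.2.val < dS then
      if ho : o.1.val < dS ∧ o.2.val < dS then
        US (⟨o.1.val, ho.1⟩, ⟨o.2.val, ho.2⟩) (⟨i.1.val, hi.1⟩, ⟨i.2.val, hi.2⟩)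
      else 0
    else if o = i then 1 else 0


/-- The bipartite unitary `U_S |i⟩|j⟩ = |i+j mod d⟩|i−j mod d⟩` on `ℂ^d ⊗ ℂ^d`. -/
def USadd (d : ℕ) : Matrix (Fin d × Fin d) (Fin d × Fin d) ℂ :=
  Matrix.of fun o i => if o.1 = i.1 + i.2 ∧ o.2 = i.1 - i.2 then 1 else 0

theorem redDM_of_rel {X Y K : Type*} [Fintype Y] [Fintype K] [DecidableEq X]
    (ψ : X × Y → ℂ) (s : ℂ) (P : X → Y → Prop) [∀ x y, Decidable (P x y)]
    (hψ : ∀ x y, ψ (x, y) = s * if P x y then 1 else 0)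
    (hu : ∀ x x' y, P x y → P x' y → x = x')
    (g : X → K → Y) (hg : ∀ x, Function.Injective (g x))
    (hP : ∀ x y, P x y ↔ ∃ k, g x k = y) :
    redDM ψ = (s * star s * (Fintype.card K : ℂ)) • (1 : Matrix X X ℂ) := by
  ext x x'
  simp only [redDM, Matrix.of_apply, Matrix.smul_apply, smul_eq_mul, hψ]
  by_cases hx : x = x'
  · subst hx
    have h1 : ∀ y, (s * if P x y then 1 else 0) * star (s * if P x y then (1:ℂ) else 0)
        = if P x y then s * star s else 0 := by
      intro y
      split_ifs <;> simp
    rw [Finset.sum_congr rfl (fun y _ => h1 y), Finset.sum_ite, Finset.sum_const_zero,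
      Finset.sum_const]
    have h2 : Finset.univ.filter (fun y => P x y) = Finset.univ.image (g x) := by
      ext y
      simp [hP]
    rw [h2, Finset.card_image_of_injective _ (hg x)]
    simp [mul_comm]
  · rw [Matrix.one_apply_ne hx, mul_zero]
    apply Finset.sum_eq_zero
    intro y _
    by_cases h1 : P x y
    · by_cases h2 : P x' y
      · exact absurd (hu _ _ _ h1 h2) hx
      · simp [h2]
    · simp [h1]

theorem vNE_of_sq {n : Type*} [Fintype n] [DecidableEq n] (ρ : Matrix n n ℂ) (c : ℝ)
    (hc : 0 < c) (h : ρ.IsHermitian) (hsq : ρ * ρ = ((c⁻¹ : ℝ) : ℂ) • ρ) (ht : ρ.trace = 1) :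
    vNE ρ = Real.logb 2 c := by
  have hev : ∀ i, h.eigenvalues i * h.eigenvalues i = c⁻¹ * h.eigenvalues i := by
    intro i
    have h1 := h.mulVec_eigenvectorBasis i
    have h2 : (ρ * ρ) *ᵥ (h.eigenvectorBasis i : n → ℂ)
        = (h.eigenvalues i * h.eigenvalues i) • (h.eigenvectorBasis i : n → ℂ) := by
      rw [← Matrix.mulVec_mulVec, h1, Matrix.mulVec_smul, h1, smul_smul]
    rw [hsq, Matrix.smul_mulVec, h1] at h2
    have hne : (h.eigenvectorBasis i : n → ℂ) ≠ 0 := by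
      intro h0
      apply h.eigenvectorBasis.orthonormal.ne_zero i
      ext j
      exact congrFun h0 j
    obtain ⟨j, hj⟩ := Function.ne_iff.mp hne
    have h3 := congrFun h2 j
    simp only [Pi.smul_apply, smul_eq_mul, Complex.real_smul] at h3
    rw [← mul_assoc] at h3
    have h4 := mul_right_cancel₀ hj h3
    exact_mod_cast h4.symm
  have hsum : ∑ i, h.eigenvalues i = 1 := by
    have := h.trace_eq_sum_eigenvalues
    rw [ht] at this
    have h2 := congrArg Complex.re this
    simpa using h2.symm
  have hn : ∀ i, Real.negMulLog (h.eigenvalues i) = h.eigenvalues i * Real.log c := by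
    intro i
    rcases eq_or_ne (h.eigenvalues i) 0 with h0 | h0
    · simp [h0]
    · have := mul_right_cancel₀ h0 (hev i)
      rw [this, Real.negMulLog, Real.log_inv]
      ring
  rw [vNE, dif_pos h, Finset.sum_congr rfl (fun i _ => hn i), ← Finset.sum_mul, hsum, one_mul,
    Real.logb]

theorem vNE_mmState {X : Type*} [Fintype X] [DecidableEq X] [Nonempty X] :
    vNE (mmState X) = Real.logb 2 (Fintype.card X) := by
  have hX : (Fintype.card X : ℂ) ≠ 0 := by simp
  apply vNE_of_sq
  · exact_mod_cast Fintype.card_pos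
  · simp [mmState, Matrix.IsHermitian, Matrix.conjTranspose_smul]
  · simp [mmState]
  · simp [mmState, Matrix.trace_smul, hX]

theorem vNE_redDM {X Y : Type*} [Fintype X] [Fintype Y] [DecidableEq X] [DecidableEq Y]
    [Nonempty Y] (ψ : X × Y → ℂ)
    (h : redDM (fun p : Y × X => star (ψ (p.2, p.1))) = mmState Y) :
    vNE (redDM ψ) = Real.logb 2 (Fintype.card Y) := by
  have hY : (Fintype.card Y : ℂ) ≠ 0 := by simp
  set V : Matrix X Y ℂ := Matrix.of fun x y => ψ (x, y) with hV
  have h1 : redDM ψ = V * Vᴴ := by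
    ext x x'
    simp [redDM, hV, Matrix.mul_apply]
  have h2 : Vᴴ * V = mmState Y := by
    rw [← h]
    ext x x'
    simp [redDM, hV, Matrix.mul_apply]
  rw [h1]
  apply vNE_of_sq
  · exact_mod_cast Fintype.card_pos
  · exact Matrix.isHermitian_mul_conjTranspose_self V
  · rw [Matrix.mul_assoc, ← Matrix.mul_assoc Vᴴ, h2]
    simp [mmState]
  · rw [Matrix.trace_mul_comm, h2]
    simp [mmState, Matrix.trace_smul, hY]

theorem fin_double_inj {d : ℕ} [NeZero d] (hd : Odd d) {a b : Fin d} (h : a + a = b + b) :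
    a = b := by
  have h1 : (a.val + a.val) % d = (b.val + b.val) % d := by
    have := congrArg Fin.val h
    simpa [Fin.val_add] using this
  have h2 : a.val + a.val ≡ b.val + b.val [MOD d] := h1
  rw [← two_mul, ← two_mul] at h2
  have h3 := Nat.ModEq.cancel_left_of_coprime (by simpa using hd) h2
  apply Fin.ext
  exact Nat.ModEq.eq_of_lt_of_lt h3 a.2 b.2

theorem fin_half {d : ℕ} [NeZero d] (hd : Odd d) (c : Fin d) : ∃ a : Fin d, a + a = c :=
  Finite.surjective_of_injective (f := fun a : Fin d => a + a)
    (fun _ _ h => fin_double_inj hd h) c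

set_option maxHeartbeats 4000000 in
/-- For every odd `d`, the map `|i⟩|j⟩ ↦ |i+j⟩|i−j⟩` (mod `d`) is unitary
and maximally I₃-scrambling: `I₃(A;C;D) = -2 log₂ d`, equivalently every two-party
marginal of its Choi state is maximally mixed. -/
theorem USadd_maximally_scrambling (d : ℕ) (hd : Odd d) :
    IsUnitaryMat (USadd d) ∧
    I3ACD (choiVec (USadd d)) = -2 * Real.logb 2 d ∧
    PerfectTensor (USadd d) := by
  have hd0 : d ≠ 0 := by rintro rfl; simp at hd
  have : NeZero d := ⟨hd0⟩
  have hdC : (d : ℂ) ≠ 0 := by exact_mod_cast hd0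
  have hinj : ∀ a b : Fin d, a + a = b + b → a = b := fun a b => fin_double_inj hd
  choose hf hhf using (fin_half hd)
  have key : ∀ a b c e : Fin d, choiVec (USadd d) ((a, b), (c, e)) =
      (Real.sqrt (Fintype.card (Fin d) * Fintype.card (Fin d)) : ℂ)⁻¹ *
        if c = a + b ∧ e = a - b then 1 else 0 := fun _ _ _ _ => rfl
  set s : ℂ := (Real.sqrt (Fintype.card (Fin d) * Fintype.card (Fin d)) : ℂ)⁻¹ with hs
  have hsd : s = (d : ℂ)⁻¹ := by
    rw [hs, Fintype.card_fin, Real.sqrt_mul_self (Nat.cast_nonneg d)]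
    simp
  have c2 : (s * star s * (Fintype.card Unit : ℂ)) • (1 : Matrix (Fin d × Fin d) _ ℂ)
      = mmState (Fin d × Fin d) := by
    rw [hsd, mmState]; congr 1; simp
  have c1 : (s * star s * (Fintype.card (Fin d) : ℂ)) • (1 : Matrix (Fin d) _ ℂ)
      = mmState (Fin d) := by
    rw [hsd, mmState]; congr 1; simp [hdC]
  have rCDu : ∀ (t : ℂ), redDM (fun p : (Fin d × Fin d) × (Fin d × Fin d) =>
      t * if p.1.1 = p.2.1 + p.2.2 ∧ p.1.2 = p.2.1 - p.2.2 then 1 else 0)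
      = (t * star t * (Fintype.card Unit : ℂ)) • 1 := by
    intro t
    apply redDM_of_rel (K := Unit) _ t
      (fun x y => x.1 = y.1 + y.2 ∧ x.2 = y.1 - y.2) (fun _ _ => rfl)
      _ (fun x _ => (hf (x.1 + x.2), x.1 - hf (x.1 + x.2))) (fun _ _ _ _ => rfl)
    · rintro ⟨c, e⟩ ⟨a, b⟩
      have h1 := hhf (c + e)
      simp only [exists_const, Prod.mk.injEq]
      constructor
      · rintro ⟨rfl, rfl⟩
        have : hf (a + b + (a - b)) = a := hinj _ _ (by rw [h1]; abel)
        rw [this]; exact ⟨rfl, by abel⟩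
      · rintro ⟨h2, h3⟩
        rw [h2] at h1 h3
        subst h3
        refine ⟨by abel, ?_⟩
        rw [sub_sub_eq_add_sub, h1]; abel
    · rintro ⟨c, e⟩ ⟨c', e'⟩ ⟨a, b⟩ ⟨h1, h2⟩ ⟨h3, h4⟩
      simp_all
  have rABu : ∀ (t : ℂ), redDM (fun p : (Fin d × Fin d) × (Fin d × Fin d) =>
      t * if p.2.1 = p.1.1 + p.1.2 ∧ p.2.2 = p.1.1 - p.1.2 then 1 else 0)
      = (t * star t * (Fintype.card Unit : ℂ)) • 1 := by
    intro t
    apply redDM_of_rel (K := Unit) _ t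
      (fun x y => y.1 = x.1 + x.2 ∧ y.2 = x.1 - x.2) (fun _ _ => rfl)
      _ (fun x _ => (x.1 + x.2, x.1 - x.2)) (fun _ _ _ _ => rfl)
    · rintro ⟨a, b⟩ ⟨c, e⟩
      simp [eq_comm]
    · rintro ⟨a, b⟩ ⟨a', b'⟩ ⟨c, e⟩ ⟨h1, h2⟩ ⟨h3, h4⟩
      simp only at h1 h2 h3 h4
      have : a = a' := hinj _ _ (by
        calc a + a = (a + b) + (a - b) := by abel
          _ = (a' + b') + (a' - b') := by rw [← h1, ← h2, h3, h4]
          _ = a' + a' := by abel)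
      subst this
      rw [h1] at h3
      rw [add_left_cancel h3]
  have rAB : rhoAB (choiVec (USadd d)) = mmState (Fin d × Fin d) := by
    rw [← c2]; exact rABu s
  have rCD : rhoCD (choiVec (USadd d)) = mmState (Fin d × Fin d) := by
    rw [← c2]; exact rCDu s
  have rAC : rhoAC (choiVec (USadd d)) = mmState (Fin d × Fin d) := by
    rw [← c2]
    apply redDM_of_rel (K := Unit) _ s
      (fun x y => x.2 = x.1 + y.1 ∧ y.2 = x.1 - y.1) (fun _ _ => rfl)
      _ (fun x _ => (x.2 - x.1, x.1 - (x.2 - x.1))) (fun _ _ _ _ => rfl)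
    · rintro ⟨a, c⟩ ⟨b, e⟩
      simp only [exists_const, Prod.mk.injEq]
      constructor
      · rintro ⟨rfl, rfl⟩
        constructor <;> abel
      · rintro ⟨rfl, rfl⟩
        constructor <;> abel
    · rintro ⟨a, c⟩ ⟨a', c'⟩ ⟨b, e⟩ ⟨h1, h2⟩ ⟨h3, h4⟩
      simp only at h1 h2 h3 h4
      rw [h2] at h4
      have := sub_left_injective h4
      subst this
      rw [h1, h3]
  have rAD : rhoAD (choiVec (USadd d)) = mmState (Fin d × Fin d) := by
    rw [← c2]
    apply redDM_of_rel (K := Unit) _ s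
      (fun x y => y.2 = x.1 + y.1 ∧ x.2 = x.1 - y.1) (fun _ _ => rfl)
      _ (fun x _ => (x.1 - x.2, x.1 + (x.1 - x.2))) (fun _ _ _ _ => rfl)
    · rintro ⟨a, c⟩ ⟨b, e⟩
      simp only [exists_const, Prod.mk.injEq]
      constructor
      · rintro ⟨rfl, rfl⟩
        constructor <;> abel
      · rintro ⟨rfl, rfl⟩
        constructor <;> abel
    · rintro ⟨a, c⟩ ⟨a', c'⟩ ⟨b, e⟩ ⟨h1, h2⟩ ⟨h3, h4⟩
      simp only at h1 h2 h3 h4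
      rw [h1] at h3
      have := add_right_cancel h3
      subst this
      rw [h2, h4]
  have rBC : rhoBC (choiVec (USadd d)) = mmState (Fin d × Fin d) := by
    rw [← c2]
    apply redDM_of_rel (K := Unit) _ s
      (fun x y => x.2 = y.1 + x.1 ∧ y.2 = y.1 - x.1) (fun _ _ => rfl)
      _ (fun x _ => (x.2 - x.1, x.2 - x.1 - x.1)) (fun _ _ _ _ => rfl)
    · rintro ⟨a, c⟩ ⟨b, e⟩
      simp only [exists_const, Prod.mk.injEq]
      constructor
      · rintro ⟨rfl, rfl⟩
        constructor <;> abel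
      · rintro ⟨rfl, rfl⟩
        constructor <;> abel
    · rintro ⟨a, c⟩ ⟨a', c'⟩ ⟨b, e⟩ ⟨h1, h2⟩ ⟨h3, h4⟩
      simp only at h1 h2 h3 h4
      rw [h2] at h4
      have := sub_right_injective h4
      subst this
      rw [h1, h3]
  have rBD : rhoBD (choiVec (USadd d)) = mmState (Fin d × Fin d) := by
    rw [← c2]
    apply redDM_of_rel (K := Unit) _ s
      (fun x y => y.2 = y.1 + x.1 ∧ x.2 = y.1 - x.1) (fun _ _ => rfl)
      _ (fun x _ => (x.2 + x.1, x.2 + x.1 + x.1)) (fun _ _ _ _ => rfl)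
    · rintro ⟨a, c⟩ ⟨b, e⟩
      simp only [exists_const, Prod.mk.injEq]
      constructor
      · rintro ⟨rfl, rfl⟩
        constructor <;> abel
      · rintro ⟨rfl, rfl⟩
        constructor <;> abel
    · rintro ⟨a, c⟩ ⟨a', c'⟩ ⟨b, e⟩ ⟨h1, h2⟩ ⟨h3, h4⟩
      simp only at h1 h2 h3 h4
      rw [h1] at h3
      have := add_left_cancel h3
      subst this
      rw [h2, h4]
  have rA : rhoA (choiVec (USadd d)) = mmState (Fin d) := by
    rw [← c1]
    apply redDM_of_rel (K := Fin d) _ s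
      (fun a y => y.2.1 = a + y.1 ∧ y.2.2 = a - y.1) (fun _ _ => rfl)
      _ (fun a b => (b, a + b, a - b))
    · intro a b b' h
      exact congrArg Prod.fst h
    · rintro a ⟨b, c, e⟩
      simp [eq_comm]
    · rintro a a' ⟨b, c, e⟩ ⟨h1, h2⟩ ⟨h3, h4⟩
      simp only at h1 h3
      rw [h1] at h3
      exact add_right_cancel h3
  have rC : rhoC (choiVec (USadd d)) = mmState (Fin d) := by
    rw [← c1]
    apply redDM_of_rel (K := Fin d) _ s
      (fun c y => c = y.1 + y.2.1 ∧ y.2.2 = y.1 - y.2.1) (fun _ _ => rfl)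
      _ (fun c a => (a, c - a, a - (c - a)))
    · intro a b b' h
      exact congrArg Prod.fst h
    · rintro c ⟨a, b, e⟩
      simp only [Prod.mk.injEq]
      constructor
      · rintro ⟨rfl, rfl⟩
        refine ⟨a, rfl, ?_, ?_⟩ <;> abel
      · rintro ⟨a, rfl, rfl, rfl⟩
        constructor <;> abel
    · rintro a a' ⟨b, c, e⟩ ⟨h1, h2⟩ ⟨h3, h4⟩
      rw [h1, h3]
  have rD : rhoD (choiVec (USadd d)) = mmState (Fin d) := by
    rw [← c1]
    apply redDM_of_rel (K := Fin d) _ s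
      (fun e y => y.2.2 = y.1 + y.2.1 ∧ e = y.1 - y.2.1) (fun _ _ => rfl)
      _ (fun e a => (a, a - e, a + (a - e)))
    · intro a b b' h
      exact congrArg Prod.fst h
    · rintro c ⟨a, b, e⟩
      simp only [Prod.mk.injEq]
      constructor
      · rintro ⟨rfl, rfl⟩
        refine ⟨a, rfl, ?_, ?_⟩ <;> abel
      · rintro ⟨a, rfl, rfl, rfl⟩
        constructor <;> abel
    · rintro a a' ⟨b, c, e⟩ ⟨h1, h2⟩ ⟨h3, h4⟩
      rw [h2, h4]
  have sACD : SACD (choiVec (USadd d)) = Real.logb 2 (Fintype.card (Fin d)) := by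
    apply vNE_redDM
    rw [← c1]
    apply redDM_of_rel (K := Fin d) _ s
      (fun b y => y.2.1 = y.1 + b ∧ y.2.2 = y.1 - b) _
      _ (fun b a => (a, a + b, a - b))
    · intro a b b' h
      exact congrArg Prod.fst h
    · rintro b ⟨a, c, e⟩
      simp [eq_comm]
    · rintro b ⟨a, c, e⟩
      simp only [key, hsd]
      split_ifs <;> simp
    · rintro a a' ⟨b, c, e⟩ ⟨h1, h2⟩ ⟨h3, h4⟩
      simp only at h1 h3
      rw [h1] at h3
      exact add_left_cancel h3
  refine ⟨⟨?_, ?_⟩, ?_, rAB, rAC, rAD, rBC, rBD, rCD⟩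
  · have h := rCDu 1
    simp only [star_one, Fintype.card_unit, Nat.cast_one, mul_one, one_smul] at h
    rw [← h]
    ext x x'
    simp [redDM, USadd, Matrix.mul_apply]
  · have h := rABu 1
    simp only [star_one, Fintype.card_unit, Nat.cast_one, mul_one, one_smul] at h
    rw [← h]
    ext x x'
    simp only [redDM, USadd, Matrix.mul_apply, Matrix.of_apply, Matrix.conjTranspose_apply]
    refine Finset.sum_congr rfl fun y _ => ?_
    split_ifs <;> simp
  · have hl : Real.logb 2 (Fintype.card (Fin d × Fin d)) = 2 * Real.logb 2 d := by
      rw [Fintype.card_prod, Fintype.card_fin, Nat.cast_mul,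
        Real.logb_mul (by exact_mod_cast hd0) (by exact_mod_cast hd0)]
      ring
    rw [I3ACD, IAC, IAD, IACD, sACD, SA, SC, SD, SAC, SAD, SCD, rA, rC, rD, rAC, rAD, rCD,
      vNE_mmState, vNE_mmState, hl, Fintype.card_fin]
    ring

end Scrambling

end
end

section
/- There exists no maximally I₃-scrambling bipartite unitary on two qubits: no unitary U on ℂ²⊗ℂ² has Choi state with I₃(A;C;D) = −2, i.e., no two-qubit unitary has all six two-party marginals of its Choi state maximally mixed (no four-qubit perfect tensor arises from a unitary). -/
open Matrix Kronecker Filter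
open scoped BigOperators Classical ComplexOrder

noncomputable section

namespace Scrambling

set_option maxHeartbeats 4000000 in
theorem shadow_identity {R : Type*} [CommRing R] (f g : Fin 2 → Fin 2 → Fin 2 → Fin 2 → R)
  (AB AC AD : Fin 2 → Fin 2 → Fin 2 → Fin 2 → R)
  (hAB : ∀ a b a' b', AB a b a' b' = ∑ c, ∑ d, f a b c d * g a' b' c d)
  (hAC : ∀ a c a' c', AC a c a' c' = ∑ b, ∑ d, f a b c d * g a' b c' d)
  (hAD : ∀ a d a' d', AD a d a' d' = ∑ b, ∑ c, f a b c d * g a' b c d') :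
  2 * ((f 0 0 0 0 * f 1 1 1 1 - f 0 0 0 1 * f 1 1 1 0 - f 0 0 1 0 * f 1 1 0 1 + f 0 0 1 1 * f 1 1 0 0
   - f 0 1 0 0 * f 1 0 1 1 + f 0 1 0 1 * f 1 0 1 0 + f 0 1 1 0 * f 1 0 0 1 - f 0 1 1 1 * f 1 0 0 0) *
  (g 0 0 0 0 * g 1 1 1 1 - g 0 0 0 1 * g 1 1 1 0 - g 0 0 1 0 * g 1 1 0 1 + g 0 0 1 1 * g 1 1 0 0
   - g 0 1 0 0 * g 1 0 1 1 + g 0 1 0 1 * g 1 0 1 0 + g 0 1 1 0 * g 1 0 0 1 - g 0 1 1 1 * g 1 0 0 0)) =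
  (∑ a, ∑ b, AB a b a b)^2 
  - (∑ a, ∑ a', (∑ b, AB a b a' b) * (∑ b, AB a' b a b))
  - (∑ b, ∑ b', (∑ a, AB a b a b') * (∑ a, AB a b' a b))
  - (∑ b, ∑ b', (∑ a, AC a b a b') * (∑ a, AC a b' a b))
  - (∑ b, ∑ b', (∑ a, AD a b a b') * (∑ a, AD a b' a b))
  + (∑ a, ∑ b, ∑ a', ∑ b', AB a b a' b' * AB a' b' a b)
  + (∑ a, ∑ b, ∑ a', ∑ b', AC a b a' b' * AC a' b' a b)
  + (∑ a, ∑ b, ∑ a', ∑ b', AD a b a' b' * AD a' b' a b) := by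
  simp only [hAB, hAC, hAD, Fin.sum_univ_two]
  ring

theorem redDM_eq {X Y : Type*} [Fintype Y] (ψ : X × Y → ℂ) :
    redDM ψ = (Matrix.of fun x y => ψ (x, y)) * (Matrix.of fun x y => ψ (x, y))ᴴ := by
  ext x x'
  simp [redDM, Matrix.mul_apply]

theorem redDM_posSemidef {X Y : Type*} [Fintype X] [Fintype Y] (ψ : X × Y → ℂ) :
    (redDM ψ).PosSemidef := by
  rw [redDM_eq]
  exact Matrix.posSemidef_self_mul_conjTranspose _

theorem vNE_flat {n : Type*} [Fintype n] [DecidableEq n] (ρ : Matrix n n ℂ) (h : ρ.IsHermitian)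
    (c : ℝ) (h2 : ρ * ρ = (c : ℂ) • ρ) (ht : ρ.trace = 1) :
    vNE ρ = - Real.log c / Real.log 2 := by
  have hs : ∑ i, h.eigenvalues i = 1 := by
    have := h.trace_eq_sum_eigenvalues
    rw [ht] at this
    have h3 := congrArg Complex.re this
    simpa using h3.symm
  have he : ∀ i, h.eigenvalues i = 0 ∨ h.eigenvalues i = c := by
    intro i
    have h1 := h.mulVec_eigenvectorBasis i
    have h3 := congrArg (fun M => M *ᵥ (⇑(h.eigenvectorBasis i) : n → ℂ)) h2
    simp only [← Matrix.mulVec_mulVec, Matrix.smul_mulVec, h1, Matrix.mulVec_smul] at h3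
    have hne : (h.eigenvectorBasis i) ≠ 0 := h.eigenvectorBasis.orthonormal.ne_zero i
    have : ∃ j, (h.eigenvectorBasis i) j ≠ 0 := by
      by_contra! hcon
      exact hne (by ext j; simpa using hcon j)
    obtain ⟨j, hj⟩ := this
    have h4 := congrFun h3 j
    simp only [Pi.smul_apply, Complex.real_smul, smul_eq_mul] at h4
    rw [← mul_assoc, ← mul_assoc] at h4
    have h5 := mul_right_cancel₀ hj h4
    have h6 : h.eigenvalues i * h.eigenvalues i = c * h.eigenvalues i := by
      have h7 := congrArg Complex.re h5
      simpa using h7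
    by_cases h0 : h.eigenvalues i = 0
    · exact Or.inl h0
    · exact Or.inr (mul_right_cancel₀ h0 h6)
  rw [vNE, dif_pos h]
  congr 1
  have : ∀ i, Real.negMulLog (h.eigenvalues i) = h.eigenvalues i * (- Real.log c) := by
    intro i
    rcases he i with h0 | h0 <;> rw [h0] <;> simp [Real.negMulLog]
  simp_rw [this]
  rw [← Finset.sum_mul, hs, one_mul]

theorem negMulLog_bound (x : ℝ) (hx : 0 ≤ x) :
    Real.negMulLog x ≤ x * Real.log 4 + (1 / 4 - x) ∧
    (Real.negMulLog x = x * Real.log 4 + (1 / 4 - x) → x = 1 / 4) := by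
  rcases hx.eq_or_lt with rfl | hx
  · norm_num
  have hpos : 0 < (4 * x)⁻¹ := by positivity
  have hl : Real.log (4 * x)⁻¹ = - Real.log 4 - Real.log x := by
    rw [Real.log_inv, Real.log_mul (by norm_num) hx.ne']; ring
  have e1 : x * (4 * x)⁻¹ = 1 / 4 := by field_simp
  constructor
  · have h1 := Real.log_le_sub_one_of_pos hpos
    rw [hl] at h1
    have h2 := mul_le_mul_of_nonneg_left h1 hx.le
    rw [Real.negMulLog]
    nlinarith
  · intro heq
    by_contra hne
    have h1 := Real.log_lt_sub_one_of_pos hpos (by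
      intro h
      apply hne
      have h9 := inv_eq_one.1 h
      linarith)
    rw [hl] at h1
    have h2 := mul_lt_mul_of_pos_left h1 hx
    rw [Real.negMulLog] at heq
    nlinarith

theorem vNE_max (ρ : Matrix (Fin 2 × Fin 2) (Fin 2 × Fin 2) ℂ) (h : ρ.PosSemidef)
    (ht : ρ.trace = 1) : vNE ρ ≤ 2 ∧ (vNE ρ = 2 → ρ = (1 / 4 : ℂ) • 1) := by
  have hs : ∑ i, h.1.eigenvalues i = 1 := by
    have := h.1.trace_eq_sum_eigenvalues
    rw [ht] at this
    have h3 := congrArg Complex.re this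
    simpa using h3.symm
  have hl2 : 0 < Real.log 2 := Real.log_pos (by norm_num)
  have hl4 : Real.log 4 = 2 * Real.log 2 := by
    rw [show (4 : ℝ) = 2 ^ 2 by norm_num, Real.log_pow]; norm_num
  have hsum : ∑ i, (h.1.eigenvalues i * Real.log 4 + (1 / 4 - h.1.eigenvalues i))
      = 2 * Real.log 2 := by
    rw [Finset.sum_add_distrib, ← Finset.sum_mul, Finset.sum_sub_distrib, hs, hl4]
    simp
  have hb := fun i => negMulLog_bound (h.1.eigenvalues i) (h.eigenvalues_nonneg i)
  rw [vNE, dif_pos h.1]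
  constructor
  · rw [div_le_iff₀ hl2, ← hsum]
    exact Finset.sum_le_sum fun i _ => (hb i).1
  · intro heq
    rw [div_eq_iff hl2.ne', ← hsum] at heq
    have h5 := (Finset.sum_eq_sum_iff_of_le fun i _ => (hb i).1).1 heq
    have h6 : ∀ i, h.1.eigenvalues i = 1 / 4 := fun i => (hb i).2 (h5 i (Finset.mem_univ i))
    have h7 := h.1.spectral_theorem
    have h8 : (diagonal (RCLike.ofReal ∘ h.1.eigenvalues) :
        Matrix (Fin 2 × Fin 2) (Fin 2 × Fin 2) ℂ) = (1 / 4 : ℂ) • 1 := by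
      ext i j
      by_cases hij : i = j
      · subst hij; simp [h6]
      · simp [hij]
    rw [h8] at h7
    rw [h7]
    simp

theorem choiVec_two (U : Matrix (Fin 2 × Fin 2) (Fin 2 × Fin 2) ℂ) :
    choiVec U = fun p => 2⁻¹ * U p.2 p.1 := by
  have h : Real.sqrt (2 * 2) = 2 := by
    rw [Real.sqrt_eq_iff_mul_self_eq] <;> norm_num
  funext p
  simp [choiVec, h]

theorem rows {U : Matrix (Fin 2 × Fin 2) (Fin 2 × Fin 2) ℂ} (hU : IsUnitaryMat U)
    (c d c' d' : Fin 2) : ∑ a, ∑ b, U (c, d) (a, b) * star (U (c', d') (a, b))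
      = if (c = c' ∧ d = d') then 1 else 0 := by
  have := congrFun (congrFun hU.1 (c, d)) (c', d')
  simpa [Matrix.mul_apply, Fintype.sum_prod_type, Matrix.one_apply] using this

theorem cols {U : Matrix (Fin 2 × Fin 2) (Fin 2 × Fin 2) ℂ} (hU : IsUnitaryMat U)
    (a b a' b' : Fin 2) : ∑ c, ∑ d, U (c, d) (a, b) * star (U (c, d) (a', b'))
      = if (a = a' ∧ b = b') then 1 else 0 := by
  have := congrFun (congrFun hU.2 (a', b')) (a, b)
  simp only [Matrix.mul_apply, Fintype.sum_prod_type, Matrix.one_apply,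
    Matrix.conjTranspose_apply, Prod.mk.injEq] at this
  simp only [mul_comm (U _ _), this, eq_comm]

theorem core (U : Matrix (Fin 2 × Fin 2) (Fin 2 × Fin 2) ℂ) (hU : IsUnitaryMat U)
    (h1 : rhoAC (choiVec U) = (1 / 4 : ℂ) • 1) (h2 : rhoAD (choiVec U) = (1 / 4 : ℂ) • 1) :
    False := by
  have hAC : ∀ a c a' c', (if (a = a' ∧ c = c') then (1 : ℂ) else 0) =
      ∑ b, ∑ d, U (c, d) (a, b) * star (U (c', d) (a', b)) := by
    intro a c a' c'
    have := congrFun (congrFun h1 (a, c)) (a', c')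
    simp only [rhoAC, redDM, choiVec_two, Matrix.of_apply, Fintype.sum_prod_type, Matrix.smul_apply,
      Matrix.one_apply, Prod.mk.injEq, smul_eq_mul, star_mul', Fin.sum_univ_two] at this ⊢
    have e : star (2⁻¹ : ℂ) = 2⁻¹ := by simp
    rw [e] at this
    linear_combination -4 * this
  have hAD : ∀ a c a' c', (if (a = a' ∧ c = c') then (1 : ℂ) else 0) =
      ∑ b, ∑ d, U (d, c) (a, b) * star (U (d, c') (a', b)) := by
    intro a c a' c'
    have := congrFun (congrFun h2 (a, c)) (a', c')
    simp only [rhoAD, redDM, choiVec_two, Matrix.of_apply, Fintype.sum_prod_type, Matrix.smul_apply,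
      Matrix.one_apply, Prod.mk.injEq, smul_eq_mul, star_mul', Fin.sum_univ_two] at this ⊢
    have e : star (2⁻¹ : ℂ) = 2⁻¹ := by simp
    rw [e] at this
    linear_combination -4 * this
  have key := shadow_identity (fun a b c d => U (c, d) (a, b))
    (fun a b c d => star (U (c, d) (a, b))) _ _ _
    (fun a b a' b' => (cols hU a b a' b').symm) hAC hAD
  have hz : ∀ z : ℂ, 2 * (z * star z) ≠ -4 := by
    intro z hz
    rw [Complex.star_def, Complex.mul_conj] at hz
    have : 2 * Complex.normSq z = -4 := by exact_mod_cast hz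
    have := Complex.normSq_nonneg z
    linarith
  simp only [← star_mul', ← star_sub, ← star_add] at key
  refine hz _ (key.trans ?_)
  simp [Fin.sum_univ_two]
  norm_num


theorem star_half : star (2⁻¹ : ℂ) = 2⁻¹ := by simp

theorem tr_AC (U : Matrix (Fin 2 × Fin 2) (Fin 2 × Fin 2) ℂ) (hU : IsUnitaryMat U) :
    (rhoAC (choiVec U)).trace = 1 := by
  have h := fun a b => cols hU a b a b
  simp only [and_self, if_true, Fin.sum_univ_two] at h
  simp only [Matrix.trace, Matrix.diag, rhoAC, redDM, choiVec_two, Matrix.of_apply,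
    Fintype.sum_prod_type, star_mul', Fin.sum_univ_two, star_half]
  linear_combination (1 / 4) * (h 0 0 + h 0 1 + h 1 0 + h 1 1)

theorem tr_AD (U : Matrix (Fin 2 × Fin 2) (Fin 2 × Fin 2) ℂ) (hU : IsUnitaryMat U) :
    (rhoAD (choiVec U)).trace = 1 := by
  have h := fun a b => cols hU a b a b
  simp only [and_self, if_true, Fin.sum_univ_two] at h
  simp only [Matrix.trace, Matrix.diag, rhoAD, redDM, choiVec_two, Matrix.of_apply,
    Fintype.sum_prod_type, star_mul', Fin.sum_univ_two, star_half]
  linear_combination (1 / 4) * (h 0 0 + h 0 1 + h 1 0 + h 1 1)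

theorem tr_ACD (U : Matrix (Fin 2 × Fin 2) (Fin 2 × Fin 2) ℂ) (hU : IsUnitaryMat U) :
    (rhoACD (choiVec U)).trace = 1 := by
  have h := fun a b => cols hU a b a b
  simp only [and_self, if_true, Fin.sum_univ_two] at h
  simp only [Matrix.trace, Matrix.diag, rhoACD, redDM, choiVec_two, Matrix.of_apply,
    Fintype.sum_prod_type, star_mul', Fin.sum_univ_two, star_half]
  linear_combination (1 / 4) * (h 0 0 + h 0 1 + h 1 0 + h 1 1)

theorem vNE_half (ρ : Matrix (Fin 2) (Fin 2) ℂ) (h : ρ = (1 / 2 : ℂ) • 1) : vNE ρ = 1 := by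
  have hl2 : 0 < Real.log 2 := Real.log_pos (by norm_num)
  rw [vNE_flat ρ (by rw [h]; ext i j; by_cases hij : i = j <;>
      simp [Matrix.one_apply, hij, eq_comm]) (1 / 2) (by rw [h]; simp)
    (by rw [h]; simp [Matrix.trace_smul])]
  rw [one_div, Real.log_inv, neg_neg, div_self hl2.ne']

theorem ent_A (U : Matrix (Fin 2 × Fin 2) (Fin 2 × Fin 2) ℂ) (hU : IsUnitaryMat U) :
    vNE (rhoA (choiVec U)) = 1 := by
  apply vNE_half
  ext a a'
  have h := fun b => cols hU a b a' b
  simp only [Fin.sum_univ_two, and_true] at h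
  simp only [rhoA, redDM, choiVec_two, Matrix.of_apply, Matrix.smul_apply, Matrix.one_apply,
    Fintype.sum_prod_type, star_mul', Fin.sum_univ_two, star_half, smul_eq_mul]
  linear_combination (1 / 4) * (h 0 + h 1)

theorem ent_C (U : Matrix (Fin 2 × Fin 2) (Fin 2 × Fin 2) ℂ) (hU : IsUnitaryMat U) :
    vNE (rhoC (choiVec U)) = 1 := by
  apply vNE_half
  ext a a'
  have h := fun b => rows hU a b a' b
  simp only [Fin.sum_univ_two, and_true] at h
  simp only [rhoC, redDM, choiVec_two, Matrix.of_apply, Matrix.smul_apply, Matrix.one_apply,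
    Fintype.sum_prod_type, star_mul', Fin.sum_univ_two, star_half, smul_eq_mul]
  linear_combination (1 / 4) * (h 0 + h 1)

theorem ent_D (U : Matrix (Fin 2 × Fin 2) (Fin 2 × Fin 2) ℂ) (hU : IsUnitaryMat U) :
    vNE (rhoD (choiVec U)) = 1 := by
  apply vNE_half
  ext a a'
  have h := fun b => rows hU b a b a'
  simp only [Fin.sum_univ_two, true_and] at h
  simp only [rhoD, redDM, choiVec_two, Matrix.of_apply, Matrix.smul_apply, Matrix.one_apply,
    Fintype.sum_prod_type, star_mul', Fin.sum_univ_two, star_half, smul_eq_mul]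
  linear_combination (1 / 4) * (h 0 + h 1)

theorem ent_CD (U : Matrix (Fin 2 × Fin 2) (Fin 2 × Fin 2) ℂ) (hU : IsUnitaryMat U) :
    vNE (rhoCD (choiVec U)) = 2 := by
  have hl2 : 0 < Real.log 2 := Real.log_pos (by norm_num)
  have hl4 : Real.log 4 = 2 * Real.log 2 := by
    rw [show (4 : ℝ) = 2 ^ 2 by norm_num, Real.log_pow]; norm_num
  have hr : rhoCD (choiVec U) = (1 / 4 : ℂ) • 1 := by
    ext ⟨c, d⟩ ⟨c', d'⟩
    have h := rows hU c d c' d'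
    simp only [Fin.sum_univ_two] at h
    simp only [rhoCD, redDM, choiVec_two, Matrix.of_apply, Matrix.smul_apply, Matrix.one_apply,
      Fintype.sum_prod_type, star_mul', Fin.sum_univ_two, star_half, smul_eq_mul, Prod.mk.injEq]
    linear_combination (1 / 4) * h
  rw [vNE_flat (rhoCD (choiVec U)) (redDM_posSemidef _ : (rhoCD (choiVec U)).PosSemidef).1 (1 / 4)
    (by rw [hr]; simp) (by rw [hr]; simp [Matrix.trace_smul])]
  rw [one_div, Real.log_inv, neg_neg, hl4]
  field_simp

theorem ent_ACD (U : Matrix (Fin 2 × Fin 2) (Fin 2 × Fin 2) ℂ) (hU : IsUnitaryMat U) :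
    vNE (rhoACD (choiVec U)) = 1 := by
  have hl2 : 0 < Real.log 2 := Real.log_pos (by norm_num)
  rw [vNE_flat (rhoACD (choiVec U)) (redDM_posSemidef _ : (rhoACD (choiVec U)).PosSemidef).1 (1 / 2) ?_
    (tr_ACD U hU)]
  · rw [one_div, Real.log_inv, neg_neg, div_self hl2.ne']
  · rw [rhoACD, redDM_eq]
    set W : Matrix (Fin 2 × Fin 2 × Fin 2) (Fin 2) ℂ := Matrix.of fun x y =>
      choiVec U ((x.1, y), x.2) with hW
    have hWW : Wᴴ * W = (1 / 2 : ℂ) • 1 := by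
      ext b b'
      have h := fun a => cols hU a b' a b
      simp only [Fin.sum_univ_two, true_and] at h
      simp only [hW, choiVec_two, Matrix.mul_apply, Matrix.conjTranspose_apply, Matrix.of_apply,
        Matrix.smul_apply, Matrix.one_apply,
        Fintype.sum_prod_type, star_mul', Fin.sum_univ_two, star_half, smul_eq_mul]
      have e : (if b = b' then (1 : ℂ) else 0) = if b' = b then 1 else 0 := by
        simp only [eq_comm]
      rw [e]
      linear_combination (1 / 4) * (h 0 + h 1)
    calc W * Wᴴ * (W * Wᴴ) = W * (Wᴴ * W) * Wᴴ := by simp only [Matrix.mul_assoc]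
      _ = _ := by rw [hWW]; simp

/-- There exists no maximally I₃-scrambling unitary on two qubits:
no two-qubit unitary has `I₃(A;C;D) = -2`, and none has all six two-party marginals of its
Choi state maximally mixed. -/
theorem no_two_qubit_perfect_unitary (U : Matrix (Fin 2 × Fin 2) (Fin 2 × Fin 2) ℂ)
    (hU : IsUnitaryMat U) :
    I3ACD (choiVec U) ≠ -2 ∧ ¬ PerfectTensor U := by
  have e4 : (Fintype.card (Fin 2 × Fin 2) : ℂ)⁻¹ = 1 / 4 := by
    norm_num
  refine ⟨fun hI => ?_, fun hP => ?_⟩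
  swap
  · obtain ⟨-, h1, h2, -⟩ := hP
    rw [mmState, e4] at h1 h2
    exact core U hU h1 h2
  have eA := ent_A U hU
  have eC := ent_C U hU
  have eD := ent_D U hU
  have eCD := ent_CD U hU
  have eACD := ent_ACD U hU
  have mAC := vNE_max (rhoAC (choiVec U)) (redDM_posSemidef _ : (rhoAC (choiVec U)).PosSemidef) (tr_AC U hU)
  have mAD := vNE_max (rhoAD (choiVec U)) (redDM_posSemidef _ : (rhoAD (choiVec U)).PosSemidef) (tr_AD U hU)
  simp only [I3ACD, IAC, IAD, IACD, SA, SC, SD, SAC, SAD, SCD, SACD] at hI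
  exact core U hU (mAC.2 (by linarith [mAC.1, mAD.1])) (mAD.2 (by linarith [mAC.1, mAD.1]))


end Scrambling

end
end
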